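/- arXiv:2601.09991 — 3 statements merged into one kernel-verified Lean document; each statement's English description precedes it below -/
import Mathlib

section
/- Let 𝕂 be ℝ or ℂ, let U be an open neighborhood of 0 in 𝕂ⁿ, and let f be analytic on U with f(0) = 0 and f not identically zero near 0, with order m, initial form f_m and next homogeneous component f_{m+1}. Let X = {x ∈ U : f(x) = 0}. Let u ∈ 𝕂ⁿ \ {0} satisfy f_m(u) = 0 and ∇f_m(u) ≠ 0. Then the geometric second-order tangent set equals the algebraic one: T²_{0,u}X = {w ∈ 𝕂ⁿ : (1/2)⟨∇f_m(u), w⟩ + f_{m+1}(u) = 0}. -/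
open Filter Topology

/-- Admissible parameter values `t` for limits `t → 0`: nonzero, and positive
when `𝕂 = ℝ` (detected by `RCLike.I = 0`). -/
def Adm {K : Type*} [RCLike K] (t : K) : Prop :=
  t ≠ 0 ∧ ((RCLike.I : K) = 0 → 0 < RCLike.re t)

/-- The geometric directional second-order tangent set `T²_{p,u} X`. -/
def secondTangentSet {K : Type*} [RCLike K] {n : ℕ}
    (X : Set (Fin n → K)) (p u : Fin n → K) : Set (Fin n → K) :=
  {w | ∃ t : ℕ → K, ∃ W : ℕ → (Fin n → K),
    (∀ k, Adm (t k)) ∧ Tendsto t atTop (𝓝 0) ∧ Tendsto W atTop (𝓝 w) ∧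
    ∀ k, p + t k • u + ((1 / 2 : K) * t k ^ 2) • W k ∈ X}

/-- The gradient vector `∇g(u) = (∂g/∂x₁(u), …, ∂g/∂xₙ(u))`. -/
noncomputable def grad {K : Type*} [RCLike K] {n : ℕ}
    (g : (Fin n → K) → K) (u : Fin n → K) : Fin n → K :=
  fun j => fderiv K g u (Pi.single j 1)

/-- The bilinear pairing `⟨a, b⟩ = ∑ i, aᵢ bᵢ`. -/
def pair {K : Type*} [RCLike K] {n : ℕ} (a b : Fin n → K) : K :=
  ∑ j, a j * b j

open Set Metric Asymptotics
open scoped NNReal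

section PowerSeries

variable {K E : Type*} [RCLike K] [NormedAddCommGroup E] [NormedSpace K E]
  {f g : E → K} {P Q : FormalMultilinearSeries K E K} {m : ℕ}

/-- Subtracting the initial form from `f` removes the terms of degree at most `m` from its
power series. -/
theorem HasFPowerSeriesAt.sub_initialForm (hP : HasFPowerSeriesAt f P 0)
    (horder : ∀ i < m, ∀ x, P i (fun _ => x) = 0) :
    HasFPowerSeriesAt (fun x => f x - P m (fun _ => x))
      (fun i => if i ≤ m then 0 else P i) 0 := by
  obtain ⟨r, hr⟩ := hP
  refine ⟨r, ?_, hr.r_pos, ?_⟩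
  · refine hr.r_le.trans (ENNReal.le_of_forall_nnreal_lt fun s hs => ?_)
    obtain ⟨C, hC, h⟩ := P.norm_mul_pow_le_of_lt_radius hs
    refine FormalMultilinearSeries.le_radius_of_bound _ C fun i => ?_
    by_cases hi : i ≤ m
    · simpa [hi] using hC.le
    · simpa [hi] using h i
  · intro y hy
    have h := (hr.hasSum hy).sub (hasSum_ite_eq m (P m fun _ => y))
    simp only [zero_add] at h ⊢
    convert h using 2 with i
    rcases lt_trichotomy i m with hi | rfl | hi
    · simp [hi.le, hi.ne, horder i hi]
    · simp
    · simp [hi.not_ge, hi.ne']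

/-- An analytic function whose power series starts in degree greater than `m` is Lipschitz on
small balls around the origin of radius `ρ`, with constant `O(ρ ^ m)`. -/
theorem HasFPowerSeriesAt.exists_norm_sub_le_mul_pow (hQ : HasFPowerSeriesAt g Q 0)
    (hQ0 : ∀ i ≤ m, Q i = 0) :
    ∃ C r : ℝ, 0 ≤ C ∧ 0 < r ∧ ∀ ρ ≤ r, ∀ x ∈ ball (0 : E) ρ, ∀ y ∈ ball (0 : E) ρ,
      ‖g x - g y‖ ≤ C * ρ ^ m * ‖x - y‖ := by
  have hder : HasFPowerSeriesAt (fderiv K g) Q.derivSeries 0 := by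
    obtain ⟨r, hr⟩ := hQ
    exact ⟨r, hr.fderiv⟩
  have hsum (y : E) : Q.derivSeries.partialSum m y = 0 :=
    Finset.sum_eq_zero fun i hi => by
      simp [Q.derivSeries_eq_zero (hQ0 (i + 1) (Finset.mem_range.1 hi))]
  have hO := hder.isBigO_sub_partialSum_pow m
  simp only [hsum, zero_add, sub_zero] at hO
  obtain ⟨C, hC, hCb⟩ := hO.exists_nonneg
  obtain ⟨r, hr, h⟩ := Metric.eventually_nhds_iff_ball.1
    (hCb.bound.and hQ.analyticAt.eventually_analyticAt)
  refine ⟨C, r, hC, hr, fun ρ hρ x hx y hy => ?_⟩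
  let : NormedSpace ℝ E := NormedSpace.restrictScalars ℝ K E
  refine (convex_ball (0 : E) ρ).norm_image_sub_le_of_norm_fderiv_le (𝕜 := K)
    (fun z hz => (h z (ball_subset_ball hρ hz)).2.differentiableAt) (fun z hz => ?_) hy hx
  refine (h z (ball_subset_ball hρ hz)).1.trans ?_
  rw [norm_pow, norm_norm]
  gcongr
  exact (mem_ball_zero_iff.1 hz).le

/-- The rescalings `z ↦ t ^ (-m) f (t z)` are uniformly close, in the Lipschitz sense near `u`, to
the derivative at `u` of the initial form. -/
theorem HasFPowerSeriesAt.eventually_approximatesLinearOn (hP : HasFPowerSeriesAt f P 0)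
    (horder : ∀ i < m, ∀ x, P i (fun _ => x) = 0) {L : E →L[K] K} {u : E}
    (hL : HasStrictFDerivAt (fun x => P m (fun _ => x)) L u) {c : ℝ≥0} (hc : 0 < c) :
    ∃ s ∈ 𝓝 u, ∀ᶠ t in 𝓝[≠] (0 : K),
      ApproximatesLinearOn (fun z => (t ^ m)⁻¹ * f (t • z)) L s c := by
  obtain ⟨C, r, hC, hr, h⟩ := (hP.sub_initialForm horder).exists_norm_sub_le_mul_pow (m := m)
    (fun i hi => if_pos hi)
  obtain ⟨s, hs, hsL⟩ := hL.approximates_deriv_on_nhds (c := c / 2) (Or.inr (half_pos hc))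
  set R : ℝ := ‖u‖ + 1
  have hR : 0 < R := by positivity
  refine ⟨s ∩ ball 0 R, inter_mem hs (isOpen_ball.mem_nhds (by simp [R])), ?_⟩
  have h1 : Tendsto (fun t : K => ‖t‖ * R) (𝓝[≠] 0) (𝓝 0) :=
    tendsto_nhdsWithin_of_tendsto_nhds (Continuous.tendsto' (by fun_prop) _ _ (by simp))
  have h2 : Tendsto (fun t : K => C * R ^ m * ‖t‖) (𝓝[≠] 0) (𝓝 0) :=
    tendsto_nhdsWithin_of_tendsto_nhds (Continuous.tendsto' (by fun_prop) _ _ (by simp))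
  filter_upwards [h1.eventually_le_const hr, h2.eventually_le_const (half_pos (NNReal.coe_pos.2 hc)),
    self_mem_nhdsWithin] with t ht1 ht2 ht0 x hx y hy
  have ht : 0 < ‖t‖ := norm_pos_iff.2 ht0
  have hmem {z : E} (hz : z ∈ ball (0 : E) R) : t • z ∈ ball (0 : E) (‖t‖ * R) := by
    rw [mem_ball_zero_iff, norm_smul]
    exact mul_lt_mul_of_pos_left (mem_ball_zero_iff.1 hz) ht
  have hG := h _ ht1 _ (hmem hx.2) _ (hmem hy.2)
  have hF := hsL x hx.1 y hy.1
  have hhom (z : E) : P m (fun _ => t • z) = t ^ m * P m (fun _ => z) := by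
    simpa using (P m).map_smul_univ (fun _ => t) (fun _ => z)
  have htm : t ^ m ≠ 0 := pow_ne_zero _ ht0
  have key : (t ^ m)⁻¹ * f (t • x) - (t ^ m)⁻¹ * f (t • y) - L (x - y)
      = (P m (fun _ => x) - P m (fun _ => y) - L (x - y)) +
        (t ^ m)⁻¹ * ((f (t • x) - P m (fun _ => t • x)) -
          (f (t • y) - P m (fun _ => t • y))) := by
    rw [hhom, hhom]; field_simp; ring
  rw [key]
  refine (norm_add_le _ _).trans ?_
  have hG' : ‖(t ^ m)⁻¹ * ((f (t • x) - P m (fun _ => t • x)) -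
      (f (t • y) - P m (fun _ => t • y)))‖ ≤ c / 2 * ‖x - y‖ := by
    rw [norm_mul, norm_inv, norm_pow]
    calc _ ≤ (‖t‖ ^ m)⁻¹ * (C * (‖t‖ * R) ^ m * ‖t • x - t • y‖) := by gcongr
      _ = C * R ^ m * ‖t‖ * ‖x - y‖ := by
        rw [← smul_sub, norm_smul, mul_pow]; field_simp
      _ ≤ _ := by gcongr
  calc _ ≤ ((c / 2 : ℝ≥0) : ℝ) * ‖x - y‖ + c / 2 * ‖x - y‖ := add_le_add hF hG'
    _ = c * ‖x - y‖ := by push_cast; ring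

/-- The second-order expansion of `f` along a parabolic arc tangent to a zero `u` of its initial
form. -/
theorem HasFPowerSeriesAt.tendsto_parabolic (hP : HasFPowerSeriesAt f P 0)
    (horder : ∀ i < m, ∀ x, P i (fun _ => x) = 0) {L : E →L[K] K} {u w : E}
    (hL : HasFDerivAt (fun x => P m (fun _ => x)) L u) (hu : P m (fun _ => u) = 0)
    {ι : Type*} {l : Filter ι} {t : ι → K} {W : ι → E} (ht0 : ∀ k, t k ≠ 0)
    (ht : Tendsto t l (𝓝 0)) (hW : Tendsto W l (𝓝 w)) :
    Tendsto (fun k => (t k)⁻¹ * ((t k ^ m)⁻¹ * f (t k • (u + (t k / 2) • W k)))) l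
      (𝓝 (1 / 2 * L w + P (m + 1) (fun _ => u))) := by
  have hz : Tendsto (fun k => u + (t k / 2) • W k) l (𝓝 u) := by
    simpa using (tendsto_const_nhds (x := u)).add ((ht.div_const 2).smul hW)
  have hsum (y : E) : P.partialSum (m + 2) y = P m (fun _ => y) + P (m + 1) (fun _ => y) := by
    rw [FormalMultilinearSeries.partialSum, Finset.sum_range_succ, Finset.sum_range_succ,
      Finset.sum_eq_zero fun i hi => horder i (Finset.mem_range.1 hi) y, zero_add]
  have hhom (i : ℕ) (a : K) (z : E) : P i (fun _ => a • z) = a ^ i * P i (fun _ => z) := by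
    simpa using (P i).map_smul_univ (fun _ => a) (fun _ => z)
  have hinit : Tendsto (fun k => (t k)⁻¹ * P m (fun _ => u + (t k / 2) • W k)) l
      (𝓝 (1 / 2 * L w)) := by
    have h := hL.hasFDerivWithinAt (s := univ) |>.lim (l := l) (c := fun k => (t k)⁻¹)
      (d := fun k => (t k / 2) • W k) (v := (1 / 2 : K) • w)
      (by simpa using (ht.div_const 2).smul hW) (by simp)
      ((hW.const_smul (1 / 2 : K)).congr fun k => by
        have := ht0 k
        rw [smul_smul]; congr 1; field_simp)
    simpa [hu] using h
  have hnext : Tendsto (fun k => P (m + 1) (fun _ => u + (t k / 2) • W k)) l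
      (𝓝 (P (m + 1) (fun _ => u))) :=
    ((P (m + 1)).cont.comp (continuous_pi fun _ => continuous_id)).continuousAt.tendsto.comp hz
  have hrem : Tendsto (fun k => (t k)⁻¹ * ((t k ^ m)⁻¹ * (f (t k • (u + (t k / 2) • W k)) -
      P.partialSum (m + 2) (t k • (u + (t k / 2) • W k))))) l (𝓝 0) := by
    have hO := hP.isBigO_sub_partialSum_pow (m + 2)
    simp only [zero_add] at hO
    have hy : Tendsto (fun k => t k • (u + (t k / 2) • W k)) l (𝓝 0) := by
      simpa using ht.smul hz
    have h1 := (isBigO_norm_right.2 (isBigO_refl (fun k => (t k)⁻¹ * (t k ^ m)⁻¹) l)).mul (hO.comp_tendsto hy)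
    have h2 : Tendsto (fun k => ‖(t k)⁻¹ * (t k ^ m)⁻¹‖ *
        ‖t k • (u + (t k / 2) • W k)‖ ^ (m + 2)) l (𝓝 0) := by
      have h3 : Tendsto (fun k => ‖t k‖ * ‖u + (t k / 2) • W k‖ ^ (m + 2)) l (𝓝 0) := by
        simpa using ht.norm.mul (hz.norm.pow (m + 2))
      refine h3.congr fun k => ?_
      have := norm_pos_iff.2 (ht0 k)
      simp only [norm_mul, norm_inv, norm_pow, norm_smul, mul_pow]
      field_simp
      ring
    simpa only [mul_assoc, Function.comp_def] using h1.trans_tendsto h2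
  have := (hinit.add hnext).add hrem
  rw [add_zero] at this
  refine this.congr fun k => ?_
  rw [hsum, hhom, hhom]
  have := ht0 k
  field_simp
  ring

/-- Any `w` solving the second-order equation is the limit of second-order displacements `W k` for
which the parabolic arc `t k • u + (t k ^ 2 / 2) • W k` lies in the zero set of `f`. -/
theorem HasFPowerSeriesAt.exists_parabolic_zeros [CompleteSpace E] (hP : HasFPowerSeriesAt f P 0)
    (horder : ∀ i < m, ∀ x, P i (fun _ => x) = 0) {L : E →L[K] K} {u w : E}
    (hL : HasStrictFDerivAt (fun x => P m (fun _ => x)) L u) (hu : P m (fun _ => u) = 0)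
    (hL0 : L ≠ 0) (hw : 1 / 2 * L w + P (m + 1) (fun _ => u) = 0)
    {t : ℕ → K} (ht0 : ∀ k, t k ≠ 0) (ht : Tendsto t atTop (𝓝 0)) :
    ∃ W : ℕ → E, Tendsto W atTop (𝓝 w) ∧
      ∀ᶠ k in atTop, f (t k • (u + (t k / 2) • W k)) = 0 := by
  have hsurj : L.range = ⊤ := LinearMap.range_eq_top.2 <|
    LinearMap.surjective (by exact_mod_cast hL0)
  set S := L.nonlinearRightInverseOfSurjective hsurj
  have hS : 0 < S.nnnorm := L.nonlinearRightInverseOfSurjective_nnnorm_pos hsurj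
  obtain ⟨s, hs, happ⟩ := hP.eventually_approximatesLinearOn horder hL
    (half_pos (inv_pos.2 hS))
  obtain ⟨δ, hδ, hδs⟩ := Metric.mem_nhds_iff.1 hs
  set b : ℕ → E := fun k => u + (t k / 2) • w with hb
  set H : ℕ → K := fun k => (t k ^ m)⁻¹ * f (t k • b k) with hH
  set ε : ℕ → ℝ := fun k => 2 * S.nnnorm * ‖H k‖ with hε
  have hHlim : Tendsto (fun k => (t k)⁻¹ * H k) atTop (𝓝 0) := by
    simpa only [hw] using hP.tendsto_parabolic horder hL.hasFDerivAt hu ht0 ht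
      (tendsto_const_nhds (x := w))
  have hε' : Tendsto (fun k => 2 * ‖t k‖⁻¹ * ε k) atTop (𝓝 0) := by
    have h := hHlim.norm.const_mul (4 * S.nnnorm : ℝ)
    simp only [norm_zero, mul_zero] at h
    refine h.congr fun k => ?_
    rw [norm_mul, norm_inv, hε]
    ring
  have hε0 : Tendsto ε atTop (𝓝 0) := by
    have h := (hε'.mul ht.norm).div_const 2
    simp only [norm_zero, mul_zero, zero_div] at h
    refine h.congr fun k => ?_
    have := norm_pos_iff.2 (ht0 k)
    field_simp
  have hblim : Tendsto b atTop (𝓝 u) := by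
    simpa using (tendsto_const_nhds (x := u)).add ((ht.div_const 2).smul_const w)
  have hex : ∀ᶠ k in atTop, ∃ z : E, ‖z - b k‖ ≤ ε k ∧ f (t k • z) = 0 := by
    filter_upwards [(tendsto_nhdsWithin_iff.2 ⟨ht, .of_forall ht0⟩).eventually happ,
      hε0.eventually_lt_const (half_pos hδ), hblim.eventually (ball_mem_nhds u (half_pos hδ))]
      with k hk hεk hbk
    have hsub : closedBall (b k) (ε k) ⊆ s := fun z hz => hδs <| by
      rw [mem_ball]
      have := dist_triangle z (b k) u
      have := mem_closedBall.1 hz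
      linarith
    obtain ⟨z, hz, hz0⟩ := hk.surjOn_closedBall_of_nonlinearRightInverse S
      (by positivity : 0 ≤ ε k) hsub (a := 0) (by
        rw [mem_closedBall, dist_zero_left, hε]
        have : (0 : ℝ) < S.nnnorm := NNReal.coe_pos.2 hS
        push_cast
        refine le_of_eq ?_
        rw [hH]
        field_simp
        norm_num)
    exact ⟨z, mem_closedBall_iff_norm.1 hz, by simpa [ht0 k] using hz0⟩
  obtain ⟨z, hz⟩ := hex.choice
  refine ⟨fun k => w + (2 * (t k)⁻¹) • (z k - b k), ?_, ?_⟩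
  · have : Tendsto (fun k => (2 * (t k)⁻¹) • (z k - b k)) atTop (𝓝 0) := by
      refine squeeze_zero_norm' ?_ hε'
      filter_upwards [hz] with k hk
      rw [norm_smul, norm_mul, norm_inv, RCLike.norm_two]
      gcongr
      exact hk.1
    simpa using this.const_add w
  · filter_upwards [hz] with k hk
    convert hk.2 using 3
    have h1 : t k / 2 * (2 * (t k)⁻¹) = 1 := by
      have := ht0 k
      field_simp
    rw [smul_add, smul_smul, h1, one_smul, ← add_assoc, hb, add_sub_cancel]

end PowerSeries

section Coordinates

variable {K : Type*} [RCLike K] {n : ℕ}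

theorem pair_grad (g : (Fin n → K) → K) (u w : Fin n → K) :
    pair (grad g u) w = fderiv K g u w := by
  conv_rhs => rw [pi_eq_sum_univ' w]
  simp [pair, grad, map_sum, mul_comm]

end Coordinates

/-- For an analytic hypersurface `X = {f = 0}` and a nonzero tangent
direction `u` with `f_m(u) = 0` and `∇f_m(u) ≠ 0`, the geometric second-order tangent
set equals the algebraic one. -/
theorem stmt0 {K : Type*} [RCLike K] {n m : ℕ}
    (U : Set (Fin n → K)) (hUopen : IsOpen U) (hU0 : (0 : Fin n → K) ∈ U)
    (f : (Fin n → K) → K) (hf : ∀ x ∈ U, AnalyticAt K f x) (hf0 : f 0 = 0)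
    (P : FormalMultilinearSeries K (Fin n → K) K) (hP : HasFPowerSeriesAt f P 0)
    (fm fm1 : (Fin n → K) → K)
    (hfm : fm = fun x => P m (fun _ => x))
    (hfm1 : fm1 = fun x => P (m + 1) (fun _ => x))
    (horder : ∀ i < m, ∀ x, P i (fun _ => x) = 0)
    (hfmne : fm ≠ 0)
    (X : Set (Fin n → K)) (hX : X = {x ∈ U | f x = 0})
    (u : Fin n → K) (hu : u ≠ 0) (hfmu : fm u = 0)
    (hgrad : grad fm u ≠ 0) :
    secondTangentSet X 0 u
      = {w : Fin n → K | (1 / 2 : K) * pair (grad fm u) w + fm1 u = 0} := by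
  have hstrict : HasStrictFDerivAt fm (fderiv K fm u) u := by
    have hcd : ContDiff K 1 fm := by
      rw [hfm]
      exact (P m).contDiff.comp (contDiff_pi.2 fun _ => contDiff_id)
    exact hcd.contDiffAt.hasStrictFDerivAt one_ne_zero
  have hL0 : fderiv K fm u ≠ 0 := fun h => hgrad (by ext j; simp [grad, h])
  have hU : U ∈ 𝓝 (0 : Fin n → K) := hUopen.mem_nhds hU0
  have harc (t : K) (w : Fin n → K) :
      0 + t • u + ((1 / 2 : K) * t ^ 2) • w = t • (u + (t / 2) • w) := by
    rw [zero_add, smul_add, smul_smul]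
    congr 2
    ring
  ext w
  simp only [secondTangentSet, mem_ofPred_eq, pair_grad, harc, hX]
  generalize fderiv K fm u = L at *
  subst hfm hfm1
  constructor
  · rintro ⟨t, W, hadm, ht, hW, hmem⟩
    refine tendsto_nhds_unique (hP.tendsto_parabolic horder hstrict.hasFDerivAt hfmu
      (fun k => (hadm k).1) ht hW) ?_
    simp only [(hmem _).2, mul_zero, tendsto_const_nhds]
  · intro hw
    set t : ℕ → K := fun k => ((1 / ((k : ℝ) + 1) : ℝ) : K)
    have hpos (k : ℕ) : (0 : ℝ) < 1 / ((k : ℝ) + 1) := by positivity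
    have hadm (k : ℕ) : Adm (t k) :=
      ⟨RCLike.ofReal_ne_zero.2 (hpos k).ne', fun _ => by
        simpa only [t, RCLike.ofReal_re] using hpos k⟩
    have ht : Tendsto t atTop (𝓝 0) := by
      rw [← RCLike.ofReal_zero (K := K)]
      exact (RCLike.continuous_ofReal.tendsto 0).comp tendsto_one_div_add_atTop_nhds_zero_nat
    obtain ⟨W, hW, hzero⟩ := hP.exists_parabolic_zeros horder hstrict hfmu hL0 hw
      (fun k => (hadm k).1) ht
    have harc0 : Tendsto (fun k => t k • (u + (t k / 2) • W k)) atTop (𝓝 0) := by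
      simpa using ht.smul ((tendsto_const_nhds (x := u)).add ((ht.div_const 2).smul hW))
    obtain ⟨N, hN⟩ := eventually_atTop.1 ((harc0.eventually_mem hU).and hzero)
    exact ⟨fun k => t (k + N), fun k => W (k + N), fun k => hadm _,
      ht.comp (tendsto_add_atTop_nat N), hW.comp (tendsto_add_atTop_nat N),
      fun k => hN _ (Nat.le_add_left N k)⟩
end

section
/- Let 𝕂 be ℝ or ℂ, let U be an open neighborhood of 0 in 𝕂ⁿ, and let f be analytic on U with f(0) = 0 and f not identically zero near 0, with order m, initial form f_m and next homogeneous component f_{m+1}. Let X = {x ∈ U : f(x) = 0}. Let u ∈ 𝕂ⁿ \ {0} satisfy f_m(u) = 0 and ∇f_m(u) ≠ 0, and let w ∈ 𝕂ⁿ satisfy (1/2)⟨∇f_m(u), w⟩ + f_{m+1}(u) = 0. Then there exist ε > 0, a vector v ∈ 𝕂ⁿ, and an analytic function s on {t : |t| < ε} with s(0) = 0 such that the analytic curve γ(t) := t u + (1/2) t² w + t² s(t) v satisfies γ(t) ∈ X for all |t| < ε; in particular γ(t) = t u + (1/2) t² w + o(t²) as t → 0 and w ∈ T²_{0,u}X.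 -/
open Filter Topology Asymptotics

theorem FormalMultilinearSeries.shift_apply_diagonal {K E F : Type*} [NontriviallyNormedField K]
    [NormedAddCommGroup E] [NormedSpace K E] [NormedAddCommGroup F] [NormedSpace K F]
    (P : FormalMultilinearSeries K E F) (i : ℕ) (x : E) :
    P.shift i (fun _ => x) x = P (i + 1) (fun _ => x) := by
  simp only [FormalMultilinearSeries.shift, Nat.succ_eq_add_one,
    ContinuousMultilinearMap.curryRight_apply]
  congr 1
  ext j
  simp [Fin.snoc]

/-- Taylor expansion with an analytic remainder, along rays: `f (t y)` equals the sum of its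
homogeneous components of degree below `k` plus `t ^ k` times a jointly analytic remainder. -/
theorem HasFPowerSeriesAt.exists_analyticAt_remainder.{a, b} {K : Type a} [RCLike K] {E : Type b}
    [NormedAddCommGroup E] [NormedSpace K E] (k : ℕ) {F : Type b}
    [NormedAddCommGroup F] [NormedSpace K F] [CompleteSpace F] {f : E → F}
    {P : FormalMultilinearSeries K E F} (hP : HasFPowerSeriesAt f P 0) :
    ∃ g : K × E → F, (∀ y, AnalyticAt K g (0, y)) ∧ (∀ y, g (0, y) = P k (fun _ => y)) ∧
      ∀ y, ∀ᶠ q : K × E in 𝓝 (0, y),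
        f (q.1 • q.2) = ∑ i ∈ Finset.range k, q.1 ^ i • P i (fun _ => q.2) + q.1 ^ k • g q := by
  induction k generalizing F with
  | zero =>
    refine ⟨fun q => f (q.1 • q.2), fun y => ?_, fun y => ?_, fun y => ?_⟩
    · refine AnalyticAt.comp_of_eq (g := f) (y := 0) hP.analyticAt ?_ (by simp)
      exact analyticAt_fst.smul analyticAt_snd
    · simp only [zero_smul]
      rw [hP.coeff_zero]
    · simp
  | succ k ih =>
    have hr : 0 < P.shift.radius := by
      rw [FormalMultilinearSeries.radius_shift]; exact hP.radius_pos
    obtain ⟨g, hg, hg0, hfg⟩ := ih (P.shift.hasFPowerSeriesOnBall hr).hasFPowerSeriesAt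
    have key : ∀ᶠ x in 𝓝 (0 : E), f x = P 0 (fun _ => x) + P.shift.sum x x := by
      filter_upwards [hP.eventually_hasSum,
        (P.shift.hasFPowerSeriesOnBall hr).hasFPowerSeriesAt.eventually_hasSum] with x h1 h2
      rw [zero_add] at h1 h2
      have h3 := (ContinuousLinearMap.apply K F x).hasSum h2
      simp only [ContinuousLinearMap.apply_apply, P.shift_apply_diagonal] at h3
      have h4 := (hasSum_nat_add_iff' 1).2 h1
      have h5 := h4.unique h3
      rw [Finset.sum_range_one] at h5
      rw [← h5]
      abel
    refine ⟨fun q => g q q.2, fun y => ?_, fun y => ?_, fun y => ?_⟩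
    · exact ((ContinuousLinearMap.id K (E →L[K] F)).analyticAt_bilinear (g (0, y), y)).comp₂
        (hg y) analyticAt_snd
    · simp only [hg0, P.shift_apply_diagonal]
    · have ht : Tendsto (fun q : K × E => q.1 • q.2) (𝓝 (0, y)) (𝓝 0) := by
        have : Continuous (fun q : K × E => q.1 • q.2) := by fun_prop
        simpa using this.tendsto (0, y)
      filter_upwards [hfg y, ht.eventually key] with q h1 h2
      rw [h2, h1, Finset.sum_range_succ']
      simp only [map_smul, add_apply, sum_apply,
        smul_apply, smul_add, Finset.smul_sum, smul_smul, pow_zero, one_smul]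
      have e0 : P 0 (fun _ => q.1 • q.2) = P 0 (fun _ => q.2) := by
        congr 1; ext i; exact i.elim0
      simp only [e0, P.shift_apply_diagonal, ← pow_succ']
      abel

open scoped ContDiff in
/-- Analytic implicit function theorem for a scalar equation in two scalar unknowns. -/
theorem AnalyticAt.exists_implicit_of_hasDerivAt {K : Type*} [RCLike K] {G : K × K → K}
    (hG : AnalyticAt K G (0, 0)) (hG0 : G (0, 0) = 0) {c : K} (hc : c ≠ 0)
    (hd : HasDerivAt (fun s => G (0, s)) c 0) :
    ∃ s : K → K, AnalyticAt K s 0 ∧ s 0 = 0 ∧ ∀ᶠ t in 𝓝 0, G (t, s t) = 0 := by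
  have cdf : ContDiffAt K ω G (0, 0) := hG.contDiffAt
  have hinv : (fderiv K G (0, 0) ∘L .inr K K K).IsInvertible := by
    have h1 : HasFDerivAt (fun s : K => G (0, s)) (fderiv K G (0, 0) ∘L .inr K K K) 0 :=
      HasFDerivAt.comp (g := G) (f := fun s : K => ((0 : K), s)) 0
        hG.differentiableAt.hasFDerivAt (hasFDerivAt_prodMk_right 0 0)
    refine ⟨ContinuousLinearEquiv.unitsEquivAut K (Units.mk0 c hc), ?_⟩
    rw [h1.unique hd.hasFDerivAt]
    ext
    simp
  have hω : (ω : WithTop ℕ∞) ≠ 0 := by simp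
  refine ⟨cdf.implicitFunction hω hinv, ?_, cdf.implicitFunction_apply_self hω hinv, ?_⟩
  · exact (cdf.contDiffAt_implicitFunction hω hinv).analyticAt
  · simpa [hG0] using cdf.eventually_apply_implicitFunction hω hinv

theorem pair_grad_eq_fderiv {K : Type*} [RCLike K] {n : ℕ} (g : (Fin n → K) → K)
    (x y : Fin n → K) : pair (grad g x) y = fderiv K g x y := by
  conv_rhs => rw [pi_eq_sum_univ' y]
  simp [pair, grad, mul_comm]

theorem exists_seq_adm_tendsto_zero (K : Type*) [RCLike K] {ε : ℝ} (hε : 0 < ε) :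
    ∃ t : ℕ → K, (∀ k, Adm (t k)) ∧ Tendsto t atTop (𝓝 0) ∧ ∀ k, ‖t k‖ < ε := by
  have hpos : ∀ k : ℕ, 0 < ε / 2 * (1 / ((k : ℝ) + 1)) := fun k => by positivity
  refine ⟨fun k => ((ε / 2 * (1 / ((k : ℝ) + 1)) : ℝ) : K), fun k => ⟨?_, fun _ => ?_⟩, ?_,
    fun k => ?_⟩
  · exact RCLike.ofReal_ne_zero.2 (hpos k).ne'
  · rw [RCLike.ofReal_re]; exact hpos k
  · have h := (tendsto_one_div_add_atTop_nhds_zero_nat (𝕜 := ℝ)).const_mul (ε / 2)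
    rw [mul_zero] at h
    have := ((RCLike.continuous_ofReal (K := K)).tendsto 0).comp h
    simpa only [RCLike.ofReal_zero, Function.comp_def] using this
  · rw [RCLike.norm_ofReal, abs_of_pos (hpos k)]
    have : 1 / ((k : ℝ) + 1) ≤ 1 := by
      rw [div_le_one (by positivity)]; linarith [(Nat.cast_nonneg k : (0 : ℝ) ≤ k)]
    nlinarith

/-- If a function vanishes to order `m` at `0`, then dividing by `t ^ (m + 1)` its values at
`t u + t ^ 2 z` leaves a function analytic in `(t, z)`, provided the initial form kills `u`. -/
theorem HasFPowerSeriesAt.exists_analyticAt_quotient {K : Type*} [RCLike K] {n m : ℕ}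
    {f : (Fin n → K) → K} {P : FormalMultilinearSeries K (Fin n → K) K}
    (hP : HasFPowerSeriesAt f P 0) (horder : ∀ i < m, ∀ x, P i (fun _ => x) = 0)
    {u : Fin n → K} (hu : P m (fun _ => u) = 0) :
    ∃ g : K × (Fin n → K) → K, (∀ z, AnalyticAt K g (0, z)) ∧
      (∀ z, g (0, z) = fderiv K (fun x => P m (fun _ => x)) u z + P (m + 1) (fun _ => u)) ∧
      ∀ z, ∀ᶠ q : K × (Fin n → K) in 𝓝 (0, z),
        f (q.1 • u + q.1 ^ 2 • q.2) = q.1 ^ (m + 1) * g q := by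
  obtain ⟨g, hg, hg0, hfg⟩ := hP.exists_analyticAt_remainder (m + 1)
  have hfm : AnalyticAt K (fun z => P m (fun _ => u + z)) 0 := by
    refine AnalyticAt.comp_of_eq (g := P m) (y := fun _ => u)
      (P m).analyticAt ?_ (by simp)
    rw [analyticAt_pi_iff]
    exact fun _ => analyticAt_const.add analyticAt_id
  obtain ⟨p, hp⟩ := hfm
  obtain ⟨h, hh, hh0, hfh⟩ := hp.exists_analyticAt_remainder 1
  have hcont : Continuous (fun q : K × (Fin n → K) => (q.1, u + q.1 • q.2)) := by fun_prop
  refine ⟨fun q => h q + g (q.1, u + q.1 • q.2), fun z => ?_, fun z => ?_, fun z => ?_⟩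
  · refine (hh z).add (AnalyticAt.comp_of_eq (hg u) ?_ (by simp))
    exact analyticAt_fst.prod (analyticAt_const.add (analyticAt_fst.smul analyticAt_snd))
  · have h1 : p 1 (fun _ => z) = fderiv K (fun x => P m (fun _ => x)) u z := by
      have := fderiv_comp_add_left (𝕜 := K) (f := fun x => P m (fun _ => x)) (x := 0) u
      rw [add_zero] at this
      rw [← this, hp.fderiv_eq]
      simp only [continuousMultilinearCurryFin1_apply]
      congr 1
    simp only [hh0, zero_smul, add_zero, hg0, h1]
  · have ht : Tendsto (fun q : K × (Fin n → K) => (q.1, u + q.1 • q.2)) (𝓝 (0, z))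
        (𝓝 (0, u)) := by
      simpa using hcont.tendsto (0, z)
    filter_upwards [ht.eventually (hfg u), hfh z] with q h1 h2
    have e : q.1 • u + q.1 ^ 2 • q.2 = q.1 • (u + q.1 • q.2) := by
      rw [smul_add, smul_smul, sq]
    have e0 : p 0 (fun _ => q.2) = 0 := by
      rw [hp.coeff_zero, add_zero, hu]
    rw [e, h1, Finset.sum_range_succ,
      Finset.sum_eq_zero fun i hi => by rw [horder i (Finset.mem_range.1 hi), smul_zero], h2]
    simp only [Finset.sum_range_one, e0, smul_eq_mul]
    ring

/-- For a hypersurface `X = {f = 0}`, a nondegenerate tangent direction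
`u` and `w` satisfying the algebraic second-order equation, there is an analytic curve
`γ(t) = t u + (1/2) t² w + t² s(t) v` inside `X`; in particular
`γ(t) = t u + (1/2) t² w + o(t²)` and `w ∈ T²_{0,u} X`. -/
theorem stmt1 {K : Type*} [RCLike K] {n m : ℕ}
    (U : Set (Fin n → K)) (hUopen : IsOpen U) (hU0 : (0 : Fin n → K) ∈ U)
    (f : (Fin n → K) → K) (hf : ∀ x ∈ U, AnalyticAt K f x) (hf0 : f 0 = 0)
    (P : FormalMultilinearSeries K (Fin n → K) K) (hP : HasFPowerSeriesAt f P 0)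
    (fm fm1 : (Fin n → K) → K)
    (hfm : fm = fun x => P m (fun _ => x))
    (hfm1 : fm1 = fun x => P (m + 1) (fun _ => x))
    (horder : ∀ i < m, ∀ x, P i (fun _ => x) = 0)
    (hfmne : fm ≠ 0)
    (X : Set (Fin n → K)) (hX : X = {x ∈ U | f x = 0})
    (u : Fin n → K) (hu : u ≠ 0) (hfmu : fm u = 0)
    (hgrad : grad fm u ≠ 0)
    (w : Fin n → K) (hw : (1 / 2 : K) * pair (grad fm u) w + fm1 u = 0) :
    ∃ ε > (0 : ℝ), ∃ v : Fin n → K, ∃ s : K → K,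
      (∀ t : K, ‖t‖ < ε → AnalyticAt K s t) ∧ s 0 = 0 ∧
      (∀ t : K, ‖t‖ < ε →
        t • u + ((1 / 2 : K) * t ^ 2) • w + (t ^ 2 * s t) • v ∈ X) ∧
      (fun t : K => t • u + ((1 / 2 : K) * t ^ 2) • w + (t ^ 2 * s t) • v
          - (t • u + ((1 / 2 : K) * t ^ 2) • w)) =o[𝓝 (0 : K)] (fun t : K => t ^ 2) ∧
      w ∈ secondTangentSet X 0 u := by
  subst hfm hfm1 hX
  simp only [pair_grad_eq_fderiv] at hw
  simp only at hfmu hw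
  obtain ⟨g, hg, hg0, hfg⟩ := hP.exists_analyticAt_quotient horder hfmu
  set L := fderiv K (fun x => P m (fun _ => x)) u with hL
  obtain ⟨v, hv⟩ : ∃ v, L v ≠ 0 := by
    obtain ⟨j, hj⟩ := Function.ne_iff.1 hgrad
    exact ⟨_, hj⟩
  let z : K × K → K × (Fin n → K) := fun q => (q.1, (1 / 2 : K) • w + q.2 • v)
  have hz : z (0, 0) = (0, (1 / 2 : K) • w) := by simp [z]
  have hzan : AnalyticAt K z (0, 0) :=
    analyticAt_fst.prod (analyticAt_const.add (analyticAt_snd.smul analyticAt_const))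
  have hG0 : ∀ s, g (z (0, s)) = s * L v := fun s => by
    simp only [z, hg0, map_add, map_smul, smul_eq_mul]
    linear_combination hw
  obtain ⟨s, hs, hs0, hGs⟩ := AnalyticAt.exists_implicit_of_hasDerivAt (G := fun q => g (z q))
    (AnalyticAt.comp_of_eq (hg _) hzan hz) (by rw [hG0, zero_mul]) hv
    (by simpa only [hG0, one_mul, id] using (hasDerivAt_id (0 : K)).mul_const (L v))
  have hcurve : ∀ t : K, t • u + ((1 / 2 : K) * t ^ 2) • w + (t ^ 2 * s t) • v
      = t • u + t ^ 2 • ((1 / 2 : K) • w + s t • v) := fun t => by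
    module
  have hzs : Tendsto (fun t => z (t, s t)) (𝓝 0) (𝓝 (0, (1 / 2 : K) • w)) := by
    have h1 : ContinuousAt (fun t => (t, s t)) (0 : K) := continuousAt_id.prodMk hs.continuousAt
    have h2 : ContinuousAt (fun t => z (t, s t)) 0 :=
      ContinuousAt.comp_of_eq hzan.continuousAt h1 (by simp [hs0])
    simpa [ContinuousAt, hs0, hz] using h2
  have hmem : ∀ᶠ t in 𝓝 (0 : K),
      t • u + ((1 / 2 : K) * t ^ 2) • w + (t ^ 2 * s t) • v ∈ {x ∈ U | f x = 0} := by
    have hc : ContinuousAt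
        (fun t : K => t • u + ((1 / 2 : K) * t ^ 2) • w + (t ^ 2 * s t) • v) 0 := by
      have := hs.continuousAt
      fun_prop
    have hUn : ∀ᶠ t in 𝓝 (0 : K),
        t • u + ((1 / 2 : K) * t ^ 2) • w + (t ^ 2 * s t) • v ∈ U :=
      hc.eventually_mem (hUopen.mem_nhds (by simpa using hU0))
    filter_upwards [hUn, hzs.eventually (hfg _), hGs] with t h1 h2 h3
    refine ⟨h1, ?_⟩
    rw [h3, mul_zero] at h2
    rw [hcurve]
    exact h2
  obtain ⟨ε, hε, hball⟩ := Metric.eventually_nhds_iff.1 (hs.eventually_analyticAt.and hmem)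
  simp only [dist_zero_right] at hball
  refine ⟨ε, hε, v, s, fun t ht => (hball ht).1, hs0, fun t ht => (hball ht).2, ?_, ?_⟩
  · have hs1 : s =o[𝓝 0] (fun _ => (1 : K)) := by
      rw [isLittleO_one_iff]
      simpa [hs0] using hs.continuousAt.tendsto
    have h2 := (((isBigO_refl (fun t : K => t ^ 2) (𝓝 0)).mul_isLittleO hs1).smul_isBigO
      (isBigO_const_const v (one_ne_zero (α := K)) (𝓝 0)))
    simpa using h2
  · obtain ⟨t, htadm, ht0, htε⟩ := exists_seq_adm_tendsto_zero K hε
    refine ⟨t, fun k => w + (2 * s (t k)) • v, htadm, ht0, ?_, fun k => ?_⟩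
    · have h1 : Tendsto (fun k => s (t k)) atTop (𝓝 0) := by
        simpa [hs0, Function.comp_def] using hs.continuousAt.tendsto.comp ht0
      simpa using ((h1.const_mul 2).smul_const v).const_add w
    · have h1 := (hball (htε k)).2
      convert h1 using 1
      module
end

section
/- Let X = {(x, y, z) ∈ ℂ³ : z² − x³y³ = 0} and let u = (u₁, u₂, 0) ∈ ℂ³ with (u₁, u₂) ≠ (0, 0). Then T²_{0,u}X = {(w₁, w₂, 0) : w₁, w₂ ∈ ℂ}. -/
open Filter Topology

/-- The directional second-order tangent set `T²_{p,u} X` of a subset of a complex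
normed space (parameters `t_k ≠ 0`, `t_k → 0`). -/
def secondTangentSetC {E : Type*} [NormedAddCommGroup E] [NormedSpace ℂ E]
    (X : Set E) (p u : E) : Set E :=
  {w | ∃ t : ℕ → ℂ, ∃ W : ℕ → E,
    (∀ k, t k ≠ 0) ∧ Tendsto t atTop (𝓝 0) ∧ Tendsto W atTop (𝓝 w) ∧
    ∀ k, p + t k • u + ((1 / 2 : ℂ) * t k ^ 2) • W k ∈ X}

/-- A complex sequence whose squares tend to zero tends to zero. -/
lemma tendsto_zero_of_tendsto_sq_zero {ι : Type*} {l : Filter ι} {c : ι → ℂ}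
    (h : Tendsto (fun k => c k ^ 2) l (𝓝 0)) : Tendsto c l (𝓝 0) := by
  rw [tendsto_zero_iff_norm_tendsto_zero] at h ⊢
  simpa using h.sqrt

/-- Along `t → 0`, the rescaled right-hand side of the equation `z² = x³y³` vanishes. -/
lemma tendsto_rescaled_product {ι : Type*} {l : Filter ι} {t A B : ι → ℂ} {a b : ℂ}
    (u₁ u₂ : ℂ) (ht : Tendsto t l (𝓝 0)) (hA : Tendsto A l (𝓝 a)) (hB : Tendsto B l (𝓝 b)) :
    Tendsto (fun k => 4 * t k ^ 2 * ((u₁ + t k * A k / 2) ^ 3 * (u₂ + t k * B k / 2) ^ 3))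
      l (𝓝 0) := by
  have h := ((ht.pow 2).const_mul 4).mul
    (((((ht.mul hA).div_const 2).const_add u₁).pow 3).mul
      ((((ht.mul hB).div_const 2).const_add u₂).pow 3))
  simpa using h

/-- The rescaled equation of `z² = x³y³` at the point `t u + t² w / 2`. -/
lemma mem_surface_iff {t : ℂ} (ht : t ≠ 0) (u₁ u₂ a b c : ℂ) :
    (0 : ℂ × ℂ × ℂ) + t • (u₁, u₂, (0 : ℂ)) + ((1 / 2 : ℂ) * t ^ 2) • (a, b, c) ∈
        {q : ℂ × ℂ × ℂ | q.2.2 ^ 2 - q.1 ^ 3 * q.2.1 ^ 3 = 0} ↔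
      c ^ 2 = 4 * t ^ 2 * ((u₁ + t * a / 2) ^ 3 * (u₂ + t * b / 2) ^ 3) := by
  have h4 : t ^ 4 / 4 ≠ 0 := div_ne_zero (pow_ne_zero _ ht) (by norm_num)
  rw [← mul_right_inj' h4, ← sub_eq_zero (a := t ^ 4 / 4 * c ^ 2)]
  simp only [Set.mem_ofPred_eq, Prod.fst_add, Prod.snd_add, Prod.smul_fst, Prod.smul_snd,
    Prod.fst_zero, Prod.snd_zero, smul_eq_mul]
  ring_nf

/-- For `X = {z² = x³y³} ⊆ ℂ³` and `u = (u₁,u₂,0) ≠ 0`, one has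
`T²_{0,u} X = {(w₁,w₂,0) : w₁, w₂ ∈ ℂ}`. -/
theorem stmt19 (u₁ u₂ : ℂ) (hu : (u₁, u₂) ≠ (0, 0)) :
    secondTangentSetC {q : ℂ × ℂ × ℂ | q.2.2 ^ 2 - q.1 ^ 3 * q.2.1 ^ 3 = 0}
        0 (u₁, u₂, 0) = {w : ℂ × ℂ × ℂ | w.2.2 = 0} := by
  ext ⟨a, b, c⟩
  simp only [Set.mem_ofPred_eq]
  constructor
  · rintro ⟨t, W, ht, ht0, hW, hX⟩
    have hc : Tendsto (fun k => (W k).2.2) atTop (𝓝 c) := hW.snd_nhds.snd_nhds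
    refine tendsto_nhds_unique hc (tendsto_zero_of_tendsto_sq_zero ?_)
    refine (tendsto_rescaled_product u₁ u₂ ht0 hW.fst_nhds hW.snd_nhds.fst_nhds).congr
      fun k => ?_
    exact ((mem_surface_iff (ht k) u₁ u₂ _ _ _).1 (hX k)).symm
  · rintro rfl
    let t : ℕ → ℂ := fun k => 1 / ((k : ℂ) + 1)
    have ht0 : Tendsto t atTop (𝓝 0) := tendsto_one_div_add_atTop_nhds_zero_nat
    have ht : ∀ k, t k ≠ 0 := fun k => one_div_ne_zero (Nat.cast_add_one_ne_zero k)
    choose s hs using fun k => IsAlgClosed.exists_pow_nat_eq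
      (4 * t k ^ 2 * ((u₁ + t k * a / 2) ^ 3 * (u₂ + t k * b / 2) ^ 3)) (n := 2) two_pos
    have hs0 : Tendsto s atTop (𝓝 0) := by
      refine tendsto_zero_of_tendsto_sq_zero ?_
      simp only [hs]
      exact tendsto_rescaled_product u₁ u₂ ht0 tendsto_const_nhds tendsto_const_nhds
    exact ⟨t, fun k => (a, b, s k), ht, ht0,
      tendsto_const_nhds.prodMk_nhds (tendsto_const_nhds.prodMk_nhds hs0),
      fun k => (mem_surface_iff (ht k) u₁ u₂ a b (s k)).2 (hs k)⟩
end
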